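/- If X is a well partial order, then the maximal order type satisfies o(X) = sup over σ ∈ X of (o(L(σ)) + 1), where L(σ) = {τ ∈ X | σ ≰ τ}. -/

import Mathlib

/-- The maximal order type of a partial order `X`: the supremum of the order
types of well orders admitting a surjective order-reflecting map onto `X`
(a linearization). -/
noncomputable def maxOrderType (X : Type) [PartialOrder X] : Ordinal :=
  sSup { a : Ordinal |
    ∃ (β : Type) (_ : LinearOrder β) (_ : WellFoundedLT β) (g : β → X),
      Function.Surjective g ∧ (∀ p q : β, g p ≤ g q → p ≤ q) ∧
        Ordinal.type ((· < ·) : β → β → Prop) = a }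

open Set Ordinal

/-! ### Natural addition of ordinals -/

/-- Natural (Hessenberg) addition of ordinals. -/
noncomputable def Ordinal.hessenbergAdd (a b : Ordinal.{0}) : Ordinal.{0} :=
  max (⨆ x : Iio a, Order.succ (Ordinal.hessenbergAdd x.1 b))
    (⨆ y : Iio b, Order.succ (Ordinal.hessenbergAdd a y.1))
termination_by (a, b)
decreasing_by
  · exact Prod.Lex.left _ _ x.2
  · exact Prod.Lex.right _ y.2

namespace Ordinal

theorem hessenbergAdd_le {a b c : Ordinal.{0}} (h₁ : ∀ x < a, hessenbergAdd x b < c)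
    (h₂ : ∀ y < b, hessenbergAdd a y < c) : hessenbergAdd a b ≤ c := by
  rw [hessenbergAdd]
  exact max_le (Ordinal.iSup_le fun x => Order.succ_le_of_lt (h₁ x.1 x.2))
    (Ordinal.iSup_le fun y => Order.succ_le_of_lt (h₂ y.1 y.2))

theorem hessenbergAdd_lt_left {a a' : Ordinal.{0}} (h : a' < a) (b : Ordinal.{0}) :
    hessenbergAdd a' b < hessenbergAdd a b := by
  rw [hessenbergAdd.eq_1 a b, ← Order.succ_le_iff]
  exact le_max_of_le_left
    (Ordinal.le_iSup (fun x : Iio a => Order.succ (hessenbergAdd x.1 b)) ⟨a', h⟩)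

theorem hessenbergAdd_lt_right (a : Ordinal.{0}) {b b' : Ordinal.{0}} (h : b' < b) :
    hessenbergAdd a b' < hessenbergAdd a b := by
  rw [hessenbergAdd.eq_1 a b, ← Order.succ_le_iff]
  exact le_max_of_le_right
    (Ordinal.le_iSup (fun y : Iio b => Order.succ (hessenbergAdd a y.1)) ⟨b', h⟩)

theorem hessenbergAdd_le_hessenbergAdd {a a' b b' : Ordinal.{0}} (ha : a ≤ a') (hb : b ≤ b') :
    hessenbergAdd a b ≤ hessenbergAdd a' b' :=
  ((show StrictMono (fun x => hessenbergAdd x b) from fun _ _ h =>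
      hessenbergAdd_lt_left h b).monotone ha).trans
    ((show StrictMono (hessenbergAdd a') from fun _ _ h =>
      hessenbergAdd_lt_right a' h).monotone hb)

/-- If `m` bounds the natural sums of remainders, natural sums of a multiple of `m` and a finite
multiple of `m` can be computed on the remainders. -/
theorem hessenbergAdd_mul_add_le {m : Ordinal.{0}}
    (hm : ∀ a < m, ∀ b < m, hessenbergAdd a b < m) (a : Ordinal.{0}) :
    ∀ b : Ordinal.{0}, b < m * ω →
      hessenbergAdd a b ≤ m * (a / m + b / m) + hessenbergAdd (a % m) (b % m) := by
  induction a using WellFoundedLT.induction with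
  | ind a iha =>
  intro b
  induction b using WellFoundedLT.induction with
  | ind b ihb =>
  intro hb
  have hm0 : m ≠ 0 := by
    rintro rfl
    simp at hb
  have key : ∀ q q' r r' : Ordinal.{0}, r < m → r' < m →
      q + 1 ≤ q' → ∀ c, m * q + hessenbergAdd r r' < m * q' + c := by
    intro q q' r r' hr hr' hq c
    calc m * q + hessenbergAdd r r' < m * q + m := by gcongr; exact hm r hr r' hr'
      _ = m * (q + 1) := by rw [mul_add, mul_one]
      _ ≤ m * q' := by gcongr
      _ ≤ m * q' + c := le_self_add
  have hfin : ∀ y ≤ b, ∃ n : ℕ, y / m = n := fun y hy => by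
    have : y / m < ω := (Ordinal.lt_mul_iff_div_lt hm0).1 (hy.trans_lt hb)
    exact Ordinal.lt_omega0.1 this
  apply hessenbergAdd_le
  · intro x hx
    refine (iha x hx b hb).trans_lt ?_
    rcases (Ordinal.div_le_left hx.le m).eq_or_lt with h | h
    · rw [h]
      gcongr
      apply hessenbergAdd_lt_left
      have := hx
      rw [← Ordinal.div_add_mod x m, ← Ordinal.div_add_mod a m, h] at this
      exact (add_lt_add_iff_left _).1 this
    · apply key _ _ _ _ (Ordinal.mod_lt _ hm0) (Ordinal.mod_lt _ hm0)
      obtain ⟨n, hn⟩ := hfin b le_rfl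
      rw [hn, add_assoc, ← Nat.cast_one, ← Nat.cast_add, add_comm n 1, Nat.cast_add, ← add_assoc,
        Nat.cast_one]
      gcongr
      exact Order.add_one_le_of_lt h
  · intro y hy
    refine (ihb y hy (hy.trans hb)).trans_lt ?_
    rcases (Ordinal.div_le_left hy.le m).eq_or_lt with h | h
    · rw [h]
      gcongr
      apply hessenbergAdd_lt_right
      have := hy
      rw [← Ordinal.div_add_mod y m, ← Ordinal.div_add_mod b m, h] at this
      exact (add_lt_add_iff_left _).1 this
    · apply key _ _ _ _ (Ordinal.mod_lt _ hm0) (Ordinal.mod_lt _ hm0)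
      rw [add_assoc]
      gcongr
      exact Order.add_one_le_of_lt h

theorem hessenbergAdd_lt_omega0_opow_mul (e : Ordinal.{0}) : ∀ q a b : Ordinal.{0},
    a < ω ^ e * q → b < ω ^ e → hessenbergAdd a b < ω ^ e * q := by
  induction e using Ordinal.limitRecOn with
  | zero =>
    intro q a b ha hb
    simp only [opow_zero, one_mul, Order.lt_one_iff] at ha hb ⊢
    subst hb
    suffices h : ∀ a, hessenbergAdd a 0 ≤ a from (h a).trans_lt ha
    intro a
    induction a using WellFoundedLT.induction with
    | ind a ih =>
    exact hessenbergAdd_le (fun x hx => (ih x hx).trans_lt hx) (by simp)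
  | add_one e ih =>
    intro q a b ha hb
    have hm : ∀ a < ω ^ e, ∀ b < ω ^ e, hessenbergAdd a b < ω ^ e := fun a ha b hb => by
      simpa using ih 1 a b (by simpa using ha) hb
    have hm0 : (ω : Ordinal.{0}) ^ e ≠ 0 := (opow_pos e omega0_pos).ne'
    rw [opow_add_one] at hb
    rw [opow_add_one, mul_assoc] at ha ⊢
    have hq : a / ω ^ e < ω * q := (Ordinal.lt_mul_iff_div_lt hm0).1 ha
    obtain ⟨n, hn⟩ := Ordinal.lt_omega0.1 ((Ordinal.lt_mul_iff_div_lt hm0).1 hb)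
    have hq' : a / ω ^ e + (n + 1 : ℕ) ≤ ω * q := by
      rw [← Ordinal.div_add_mod (a / ω ^ e) ω]
      have h1 : a / ω ^ e / ω + 1 ≤ q :=
        Order.add_one_le_of_lt ((Ordinal.lt_mul_iff_div_lt omega0_ne_zero).1 hq)
      obtain ⟨k, hk⟩ := Ordinal.lt_omega0.1 (Ordinal.mod_lt (a / ω ^ e) omega0_ne_zero)
      rw [hk]
      calc ω * (a / ω ^ e / ω) + k + (n + 1 : ℕ)
          = ω * (a / ω ^ e / ω) + (k + (n + 1) : ℕ) := by rw [add_assoc, ← Nat.cast_add]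
        _ ≤ ω * (a / ω ^ e / ω) + ω := by gcongr; exact (natCast_lt_omega0 _).le
        _ = ω * (a / ω ^ e / ω + 1) := by rw [mul_add, mul_one]
        _ ≤ ω * q := by gcongr
    calc hessenbergAdd a b
        ≤ ω ^ e * (a / ω ^ e + b / ω ^ e) + hessenbergAdd (a % ω ^ e) (b % ω ^ e) :=
          hessenbergAdd_mul_add_le hm a b hb
      _ < ω ^ e * (a / ω ^ e + b / ω ^ e) + ω ^ e := by
          gcongr
          exact hm _ (Ordinal.mod_lt _ hm0) _ (Ordinal.mod_lt _ hm0)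
      _ = ω ^ e * (a / ω ^ e + (n + 1 : ℕ)) := by
          rw [hn, Nat.cast_add, Nat.cast_one, ← add_assoc, mul_add _ _ 1, mul_one]
      _ ≤ ω ^ e * (ω * q) := by gcongr
  | limit e he ih =>
    intro q a b ha hb
    obtain ⟨d, hd, hbd⟩ := (lt_opow_of_isSuccLimit omega0_ne_zero he).1 hb
    obtain ⟨c, hc⟩ := opow_dvd_opow (ω : Ordinal.{0}) hd.le
    rw [hc, mul_assoc] at ha ⊢
    exact ih d hd _ _ _ ha hbd

theorem exists_eq_omega0_opow_mul_add_one (a : Ordinal.{0}) (ha : a ≠ 0) :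
    ∃ e q : Ordinal.{0}, a = ω ^ e * (q + 1) := by
  induction a using WellFoundedLT.induction with
  | ind a ih =>
  have hm0 : (ω : Ordinal.{0}) ^ log ω a ≠ 0 := (opow_pos _ omega0_pos).ne'
  by_cases hr : a % ω ^ log ω a = 0
  · have h := Ordinal.div_add_mod a (ω ^ log ω a)
    rw [hr, add_zero] at h
    obtain ⟨n, hn⟩ := Ordinal.lt_omega0.1 (div_opow_log_lt a one_lt_omega0)
    rw [hn] at h
    cases n with
    | zero => simp at h; exact absurd h.symm ha
    | succ n => exact ⟨log ω a, n, by rw [← Nat.cast_one, ← Nat.cast_add]; exact h.symm⟩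
  · have hlt : a % ω ^ log ω a < ω ^ log ω a := Ordinal.mod_lt _ hm0
    obtain ⟨e, q, h⟩ := ih _ (hlt.trans_le (opow_log_le_self ω ha)) hr
    have he : e ≤ log ω a := by
      rw [h] at hlt
      have : (ω : Ordinal.{0}) ^ e < ω ^ log ω a :=
        lt_of_le_of_lt (le_mul_left _ (by simp)) hlt
      exact ((opow_lt_opow_iff_right one_lt_omega0).1 this).le
    obtain ⟨c, hc⟩ := opow_dvd_opow (ω : Ordinal.{0}) he
    refine ⟨e, c * (a / ω ^ log ω a) + q, ?_⟩
    conv_lhs => rw [← Ordinal.div_add_mod a (ω ^ log ω a), h]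
    nth_rewrite 1 [hc]
    rw [add_assoc, mul_add (ω ^ e) (c * _), mul_assoc]

theorem exists_cofinal_family (a : Ordinal.{0}) :
    ∃ (K : Type) (_ : LinearOrder K) (_ : WellFoundedLT K) (t : K → Ordinal.{0}),
      (∀ k, t k < a) ∧ (∀ b < a, ∃ k, b ≤ t k) ∧ ∀ k : K, Cardinal.mk (Iio k) < a.cof := by
  obtain ⟨s, hs, hs'⟩ := exists_ord_cof_eq a.ToType
  refine ⟨s, inferInstance, inferInstance, fun k => typein (α := a.ToType) (· < ·) k.1,
    fun k => typein_lt_self _, fun b hb => ?_, fun k => ?_⟩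
  · have hb' : b < type ((· < ·) : a.ToType → a.ToType → Prop) := by simpa using hb
    obtain ⟨k, hk, hle⟩ := hs (enum (α := a.ToType) (· < ·) ⟨b, hb'⟩)
    refine ⟨⟨k, hk⟩, ?_⟩
    rw [← typein_enum (α := a.ToType) (· < ·) hb']
    exact (typein_le_typein (α := a.ToType) (· < ·)).2 (not_lt.2 hle)
  · have h := typein_lt_type ((· < ·) : s → s → Prop) k
    rw [hs', cof_toType, Cardinal.lt_ord, card_typein] at h
    exact h

end Ordinal

/-! ### The rank of a set of elements of a well partial order -/

section Rank

variable {X : Type} [PartialOrder X]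

/-- The elements of `S` that are not above `σ`. -/
def residualSet (S : Set X) (σ : X) : Set X := {τ ∈ S | ¬ σ ≤ τ}

theorem residualSet_subset (S : Set X) (σ : X) : residualSet S σ ⊆ S := sep_subset _ _

/-- `T` is contained in the residual of `S` by one of the elements of `S`. -/
def IsResidual (T S : Set X) : Prop := ∃ σ ∈ S, T ⊆ residualSet S σ

theorem isResidual_residualSet {S : Set X} {σ : X} (hσ : σ ∈ S) : IsResidual (residualSet S σ) S :=
  ⟨σ, hσ, subset_rfl⟩

theorem isWellFounded_isResidual (hwpo : ∀ s : ℕ → X, ∃ i j, i < j ∧ s i ≤ s j) :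
    IsWellFounded (Set X) IsResidual := by
  refine ⟨wellFounded_iff_isEmpty_descending_chain.2 ⟨fun ⟨f, hf⟩ => ?_⟩⟩
  choose σ hσ hsub using hf
  have hanti : Antitone f := antitone_nat_of_succ_le fun n => (hsub n).trans (residualSet_subset _ _)
  obtain ⟨i, j, hij, hle⟩ := hwpo σ
  exact (hsub i (hanti (Nat.succ_le_of_lt hij) (hσ j))).2 hle

/-- There is a well-ordered linear extension of `S` of order type at least `a`. -/
def HasLinearization (S : Set X) (a : Ordinal.{0}) : Prop :=
  ∃ (r : S → S → Prop) (_ : IsWellOrder S r), (∀ x y, x < y → r x y) ∧ a ≤ Ordinal.type r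

theorem HasLinearization.mono {S : Set X} {a b : Ordinal.{0}} (h : HasLinearization S b)
    (hab : a ≤ b) : HasLinearization S a := by
  obtain ⟨r, hr, hlt, hle⟩ := h
  exact ⟨r, hr, hlt, hab.trans hle⟩

theorem HasLinearization.add {S A B : Set X} {a b : Ordinal.{0}} (hA : HasLinearization A a)
    (hB : HasLinearization B b) (hS : S = A ∪ B) (hAB : ∀ x ∈ A, ∀ y ∈ B, ¬ y ≤ x) :
    HasLinearization S (a + b) := by
  classical
  obtain ⟨r, hr, hrlt, hra⟩ := hA
  obtain ⟨s, hs, hslt, hsb⟩ := hB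
  subst hS
  have hdisj : Disjoint A B := Set.disjoint_left.2 fun x hx hx' => hAB x hx x hx' le_rfl
  let e : ↥(A ∪ B) ≃ A ⊕ B := Equiv.Set.union hdisj
  have hwo : IsWellOrder ↥(A ∪ B) (e ⁻¹'o Sum.Lex r s) :=
    (RelIso.preimage e (Sum.Lex r s)).toRelEmbedding.isWellOrder
  refine ⟨e ⁻¹'o Sum.Lex r s, hwo, ?_, ?_⟩
  · intro x y hxy
    obtain ⟨x, rfl⟩ := e.symm.surjective x
    obtain ⟨y, rfl⟩ := e.symm.surjective y
    simp only [Order.Preimage, Equiv.apply_symm_apply]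
    rcases x with x | x <;> rcases y with y | y
    · exact Sum.Lex.inl (hrlt _ _ (by simpa [e] using hxy))
    · exact Sum.Lex.sep _ _
    · exact absurd (by simpa [e] using hxy.le) (hAB y y.2 x x.2)
    · exact Sum.Lex.inr (hslt _ _ (by simpa [e] using hxy))
  · rw [Ordinal.type_preimage, Ordinal.type_sum_lex]
    gcongr

/-- Linearizations of the fibres of a monotone map into a well order glue. -/
theorem HasLinearization.of_fibres {K : Type} [LinearOrder K] [WellFoundedLT K] {S : Set X}
    (h : X → K) (hmono : MonotoneOn h S) (t : K → Ordinal.{0})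
    (hfib : ∀ k, HasLinearization {x ∈ S | h x = k} (t k)) {a : Ordinal.{0}}
    (ha : ∀ b < a, ∃ k, b < t k) : HasLinearization S a := by
  choose r hr hrlt hrt using hfib
  let f : S → K ×ₗ Ordinal.{0} := fun x =>
    toLex (h x.1, typein (r (h x.1)) ⟨x.1, x.2, rfl⟩)
  have hf : ∀ k (x y : {x ∈ S | h x = k}),
      f ⟨x.1, x.2.1⟩ < f ⟨y.1, y.2.1⟩ ↔ r k x y := by
    rintro k ⟨x, hxS, rfl⟩ ⟨y, hyS, hy⟩
    have : ∀ k (hk : h y = k) (hx : h x = k),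
        typein (r (h y)) ⟨y, hyS, rfl⟩ = typein (r k) ⟨y, hyS, hk⟩ := by
      rintro _ rfl _; rfl
    simp only [f, Prod.Lex.toLex_lt_toLex, hy, lt_irrefl, true_and, false_or]
    rw [this _ hy rfl, typein_lt_typein]
  have hinj : Function.Injective f := by
    rintro ⟨x, hx⟩ ⟨y, hy⟩ hxy
    have hk : h y = h x := (congrArg (fun p => (ofLex p).1) hxy).symm
    have h1 := (hf (h x) ⟨x, hx, rfl⟩ ⟨y, hy, hk⟩).not.1 hxy.not_lt
    have h2 := (hf (h x) ⟨y, hy, hk⟩ ⟨x, hx, rfl⟩).not.1 hxy.not_gt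
    have := (trichotomous_of (r (h x)) ⟨x, hx, rfl⟩ ⟨y, hy, hk⟩).resolve_left h1
    have := this.resolve_right h2
    simpa using this
  let e : (InvImage (· < ·) f) ↪r ((· < ·) : K ×ₗ Ordinal.{0} → _ → Prop) :=
    ⟨⟨f, hinj⟩, Iff.rfl⟩
  have hwo : IsWellOrder S (InvImage (· < ·) f) := e.isWellOrder
  refine ⟨InvImage (· < ·) f, hwo, ?_, le_of_forall_lt fun b hb => ?_⟩
  · rintro ⟨x, hx⟩ ⟨y, hy⟩ hxy
    rcases (hmono hx hy hxy.le).eq_or_lt with hk | hk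
    · exact (hf (h y) ⟨x, hx, hk⟩ ⟨y, hy, rfl⟩).2 (hrlt _ _ _ hxy)
    · exact Prod.Lex.toLex_lt_toLex.2 (Or.inl hk)
  · obtain ⟨k, hk⟩ := ha b hb
    refine (hk.trans_le (hrt k)).trans_le (RelEmbedding.ordinal_type_le (r := r k) ?_)
    refine ⟨⟨fun x => ⟨x.1, x.2.1⟩, fun x y hxy => ?_⟩, hf k _ _⟩
    simpa [Subtype.ext_iff] using hxy

variable [hwf : IsWellFounded (Set X) IsResidual]

/-- The rank of a set under passing to residuals. -/
noncomputable def residualRank (S : Set X) : Ordinal.{0} :=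
  IsWellFounded.rank IsResidual S

theorem residualRank_lt {T S : Set X} (h : IsResidual T S) : residualRank T < residualRank S :=
  IsWellFounded.rank_lt_of_rel h

theorem residualRank_le {S : Set X} {a : Ordinal.{0}}
    (h : ∀ T, IsResidual T S → residualRank T < a) : residualRank S ≤ a := by
  rw [residualRank, IsWellFounded.rank_eq]
  exact Ordinal.iSup_le fun T => Order.succ_le_of_lt (h T.1 T.2)

theorem residualRank_mono {S T : Set X} (h : S ⊆ T) : residualRank S ≤ residualRank T := by
  refine residualRank_le fun R ⟨σ, hσ, hR⟩ => residualRank_lt ⟨σ, h hσ, fun τ hτ => ?_⟩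
  exact ⟨h (hR hτ).1, (hR hτ).2⟩

theorem exists_le_residualRank_residualSet {S : Set X} {a : Ordinal.{0}} (h : a < residualRank S) :
    ∃ σ ∈ S, a ≤ residualRank (residualSet S σ) := by
  by_contra! hc
  refine h.not_ge (residualRank_le fun T ⟨σ, hσ, hT⟩ => ?_)
  exact (residualRank_mono hT).trans_lt (hc σ hσ)

theorem residualRank_union_le (A B : Set X) :
    residualRank (A ∪ B) ≤ hessenbergAdd (residualRank A) (residualRank B) := by
  suffices h : ∀ C : Set X, ∀ A B, C = A ∪ B →
      residualRank C ≤ hessenbergAdd (residualRank A) (residualRank B) from h _ A B rfl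
  intro C
  induction C using hwf.wf.induction with
  | h C ih =>
  rintro A B rfl
  refine residualRank_le fun T hT => ?_
  have hdec : T = (T ∩ A) ∪ (T ∩ B) := by
    obtain ⟨σ, -, hT⟩ := hT
    rw [← inter_union_distrib_left]
    exact (inter_eq_left.2 (hT.trans (residualSet_subset _ _))).symm
  refine (ih T hT _ _ hdec).trans_lt ?_
  obtain ⟨σ, hσ | hσ, hT⟩ := hT
  · have h : residualRank (T ∩ A) < residualRank A :=
      residualRank_lt ⟨σ, hσ, fun τ hτ => ⟨hτ.2, (hT hτ.1).2⟩⟩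
    exact (hessenbergAdd_lt_left h _).trans_le
      (hessenbergAdd_le_hessenbergAdd le_rfl (residualRank_mono inter_subset_right))
  · have h : residualRank (T ∩ B) < residualRank B :=
      residualRank_lt ⟨σ, hσ, fun τ hτ => ⟨hτ.2, (hT hτ.1).2⟩⟩
    exact (hessenbergAdd_lt_right _ h).trans_le
      (hessenbergAdd_le_hessenbergAdd (residualRank_mono inter_subset_right) le_rfl)

theorem residualRank_add_le {A B : Set X} (h : ∀ a ∈ A, ∀ b ∈ B, ¬ b ≤ a) :
    residualRank A + residualRank B ≤ residualRank (A ∪ B) := by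
  induction B using hwf.wf.induction with
  | h B ih =>
  refine le_of_forall_lt fun c hc => ?_
  rcases lt_or_ge c (residualRank A) with hcA | hcA
  · exact hcA.trans_le (residualRank_mono subset_union_left)
  · obtain ⟨d, rfl⟩ := exists_add_of_le hcA
    obtain ⟨σ, hσ, hd⟩ := exists_le_residualRank_residualSet ((add_lt_add_iff_left _).1 hc)
    have hres := isResidual_residualSet hσ
    calc residualRank A + d ≤ residualRank A + residualRank (residualSet B σ) := by gcongr
      _ ≤ residualRank (A ∪ residualSet B σ) := ih _ hres fun a ha b hb => h a ha b hb.1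
      _ < residualRank (A ∪ B) := by
        refine residualRank_lt ⟨σ, Or.inr hσ, ?_⟩
        rintro τ (hτ | hτ)
        · exact ⟨Or.inl hτ, h τ hτ σ hσ⟩
        · exact ⟨Or.inr hτ.1, hτ.2⟩

theorem hasLinearization_omega0_opow {e : Ordinal.{0}} (he : e ≠ 0) {S : Set X}
    (hS : residualRank S = ω ^ e)
    (ih : ∀ T : Set X, residualRank T < ω ^ e → HasLinearization T (residualRank T)) :
    HasLinearization S (ω ^ e) := by
  have hlim : Order.IsSuccLimit (ω ^ e : Ordinal.{0}) := isSuccLimit_opow_left isSuccLimit_omega0 he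
  have hprinc : ∀ a < ω ^ e, ∀ b < ω ^ e, hessenbergAdd a b < ω ^ e := fun a ha b hb => by
    simpa using hessenbergAdd_lt_omega0_opow_mul e 1 a b (by simpa using ha) hb
  have hres : ∀ σ ∈ S, residualRank (residualSet S σ) < ω ^ e := fun σ hσ =>
    hS ▸ residualRank_lt (isResidual_residualSet hσ)
  obtain ⟨K, _, _, t, ht, htcof, hcard⟩ := exists_cofinal_family (ω ^ e)
  obtain ⟨I, ⟨hIS, hIcof⟩, hImin⟩ := hwf.wf.has_min
    {I : Set X | I ⊆ S ∧ ∀ a < ω ^ e, ∃ σ ∈ I, a ≤ residualRank (residualSet S σ)}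
    ⟨S, subset_rfl, fun a ha => exists_le_residualRank_residualSet (hS ▸ ha)⟩
  have hbound : ∀ x ∈ I, ∃ b < ω ^ e, ∀ y ∈ I, b ≤ residualRank (residualSet S y) → x ≤ y := by
    intro x hx
    by_contra! hc
    refine hImin (residualSet I x) ⟨(residualSet_subset _ _).trans hIS, fun a ha => ?_⟩
      (isResidual_residualSet hx)
    obtain ⟨y, hy, hay, hxy⟩ := hc a ha
    exact ⟨y, ⟨hy, hxy⟩, hay⟩
  choose! b hb hbI using hbound
  have step : ∀ (k : K) (prev : Iio k → I), ∃ y : I,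
      t k ≤ residualRank {τ ∈ S | ¬ y.1 ≤ τ ∧ ∀ j, (prev j).1 ≤ τ} := by
    intro k prev
    have hsup : ⨆ j, b (prev j).1 < ω ^ e := iSup_lt_of_lt_cof (hcard k) fun j => hb _ (prev j).2
    obtain ⟨z, hz, hzb⟩ := hIcof _ hsup
    have hprev : ∀ j, (prev j).1 ≤ z := fun j =>
      hbI _ (prev j).2 z hz ((Ordinal.le_iSup (fun j => b (prev j).1) j).trans hzb)
    let U : Set X := {τ ∈ S | ∃ j, ¬ (prev j).1 ≤ τ}
    have hU : residualRank U < ω ^ e := by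
      refine (residualRank_mono ?_).trans_lt (hres z (hIS hz))
      rintro τ ⟨hτ, j, hj⟩
      exact ⟨hτ, fun h => hj ((hprev j).trans h)⟩
    obtain ⟨y, hy, hyU⟩ := hIcof _ (hprinc _ hU _ (ht k))
    refine ⟨⟨y, hy⟩, le_of_not_gt fun hlt => hyU.not_gt ?_⟩
    refine ((residualRank_mono ?_).trans (residualRank_union_le U _)).trans_lt
      (hessenbergAdd_lt_right _ hlt)
    rintro τ ⟨hτ, hyτ⟩
    by_cases h : ∃ j, ¬ (prev j).1 ≤ τ
    · exact Or.inl ⟨hτ, h⟩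
    · exact Or.inr ⟨hτ, hyτ, by simpa using h⟩
  choose F hF using step
  let y : K → I := (wellFounded_lt (α := K)).fix fun k prev => F k fun j => prev j.1 j.2
  let D : K → Set X := fun k => {τ ∈ S | ¬ (y k).1 ≤ τ ∧ ∀ j < k, (y j).1 ≤ τ}
  have hD : ∀ k, t k ≤ residualRank (D k) := by
    intro k
    have hy : y k = F k fun j => y j.1 := WellFounded.fix_eq _ _ _
    have h := hF k fun j => y j.1
    rw [← hy] at h
    simpa only [D, Subtype.forall, mem_Iio] using h
  have hDlt : ∀ k, residualRank (D k) < ω ^ e := fun k =>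
    (residualRank_mono (show D k ⊆ residualSet S (y k).1 from fun τ hτ => ⟨hτ.1, hτ.2.1⟩)).trans_lt
      (hres (y k).1 (hIS (y k).2))
  have htcof' : ∀ a < ω ^ e, ∃ k, a < t k := fun a ha => by
    obtain ⟨k, hk⟩ := htcof (a + 1) (hlim.add_one_lt ha)
    exact ⟨k, (lt_add_one a).trans_le hk⟩
  have hex : ∀ τ, ∃ k, τ ∈ S → τ ∈ D k := by
    intro τ
    by_cases hτ : τ ∈ S
    · have hne : {k | ¬ (y k).1 ≤ τ}.Nonempty := by
        by_contra hc
        obtain ⟨k, hk⟩ := htcof' _ (hres τ hτ)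
        refine (hk.trans_le (hD k)).not_ge (residualRank_mono fun x hx => ⟨hx.1, fun hle => ?_⟩)
        exact hc ⟨k, fun h => hx.2.1 (h.trans hle)⟩
      obtain ⟨k, hk, hmin⟩ := (wellFounded_lt (α := K)).has_min _ hne
      exact ⟨k, fun _ => ⟨hτ, hk, fun j hj => by_contra fun h => hmin j h hj⟩⟩
    · obtain ⟨k, -⟩ := htcof 0 (opow_pos e omega0_pos)
      exact ⟨k, fun h => absurd h hτ⟩
  choose h hh using hex
  refine HasLinearization.of_fibres h ?_ t (fun k => ?_) htcof'
  · intro x hx x' hx' hle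
    refine le_of_not_gt fun hlt => ?_
    exact (hh x' hx').2.1 (((hh x hx).2.2 _ hlt).trans hle)
  · have hfib : {x ∈ S | h x = k} = D k := by
      ext x
      constructor
      · rintro ⟨hx, rfl⟩
        exact hh x hx
      · intro hx
        refine ⟨hx.1, le_antisymm (le_of_not_gt fun hlt => ?_) (le_of_not_gt fun hlt => ?_)⟩
        · exact hx.2.1 ((hh x hx.1).2.2 _ hlt)
        · exact (hh x hx.1).2.1 (hx.2.2 _ hlt)
    rw [hfib]
    exact (ih _ (hDlt k)).mono (hD k)

theorem hasLinearization_of_residualRank_le_one {S : Set X} (hS : residualRank S ≤ 1) :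
    HasLinearization S (residualRank S) := by
  have hsub : ∀ x ∈ S, ∀ y ∈ S, x ≤ y := by
    intro x hx y hy
    by_contra hxy
    have h1 : residualRank (residualSet S x) < 1 :=
      (residualRank_lt (isResidual_residualSet hx)).trans_le hS
    have h2 := residualRank_lt
      (isResidual_residualSet (show y ∈ residualSet S x from ⟨hy, hxy⟩))
    rw [Order.lt_one_iff] at h1
    rw [h1] at h2
    exact not_lt_zero h2
  have : Subsingleton S :=
    ⟨fun x y => Subtype.ext (le_antisymm (hsub x x.2 y y.2) (hsub y y.2 x x.2))⟩
  have hwo : IsWellOrder S ((· < ·) : S → S → Prop) := Subsingleton.isWellOrder _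
  refine ⟨(· < ·), hwo, fun _ _ h => h, ?_⟩
  rcases isEmpty_or_nonempty S with hE | hE
  · refine (residualRank_le fun T ⟨σ, hσ, _⟩ => ?_).trans zero_le
    exact (hE.false ⟨σ, hσ⟩).elim
  · refine hS.trans (Order.one_le_iff_pos.2 (pos_iff_ne_zero.2 ?_))
    exact type_ne_zero_iff_nonempty.2 hE

/-- Every set has a linearization of order type at least its rank. -/
theorem hasLinearization_residualRank (S : Set X) : HasLinearization S (residualRank S) := by
  induction h : residualRank S using WellFoundedLT.induction generalizing S with
  | ind a ih =>
  subst h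
  by_cases h1 : residualRank S ≤ 1
  · exact hasLinearization_of_residualRank_le_one h1
  obtain ⟨e, q, hq⟩ := exists_eq_omega0_opow_mul_add_one (residualRank S)
    (fun h0 => h1 (h0 ▸ zero_le_one))
  rcases eq_or_ne q 0 with rfl | hq0
  · rw [zero_add, mul_one] at hq
    have he : e ≠ 0 := by
      rintro rfl
      exact h1 (by rw [hq, opow_zero])
    rw [hq]
    exact hasLinearization_omega0_opow he hq fun T hT => ih _ (hq ▸ hT) T rfl
  · have hω : (0 : Ordinal.{0}) < ω ^ e := opow_pos e omega0_pos
    have hadd : residualRank S = ω ^ e * q + ω ^ e := by rw [hq, mul_add, mul_one]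
    have hlt : ω ^ e * q < residualRank S := by
      rw [hadd]
      exact lt_add_of_pos_right _ hω
    obtain ⟨σ, hσ, hle⟩ := exists_le_residualRank_residualSet hlt
    have hσlt := residualRank_lt (isResidual_residualSet hσ)
    have hunion : S = residualSet S σ ∪ {τ ∈ S | σ ≤ τ} := by
      ext τ
      simp only [residualSet, mem_union, mem_ofPred_eq]
      tauto
    have hsep : ∀ x ∈ residualSet S σ, ∀ y ∈ {τ ∈ S | σ ≤ τ}, ¬ y ≤ x :=
      fun x hx y hy hyx => hx.2 (hy.2.trans hyx)
    have hge : ω ^ e ≤ residualRank {τ ∈ S | σ ≤ τ} := by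
      by_contra! hc
      have hu := residualRank_union_le (residualSet S σ) {τ ∈ S | σ ≤ τ}
      rw [← hunion] at hu
      refine hu.not_gt ?_
      rw [hq] at hσlt ⊢
      exact hessenbergAdd_lt_omega0_opow_mul e _ _ _ hσlt hc
    have hup : residualRank {τ ∈ S | σ ≤ τ} ≤ ω ^ e := by
      have hu := residualRank_add_le hsep
      rw [← hunion, hadd] at hu
      exact (add_le_add_iff_left _).1 ((add_le_add_left hle _).trans hu)
    have hωlt : ω ^ e < residualRank S := by
      rw [hq]
      refine lt_mul_of_one_lt_right hω ?_
      exact (Order.one_le_iff_pos.2 (pos_iff_ne_zero.2 hq0)).trans_lt (lt_add_one q)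
    have heq := hup.antisymm hge
    rw [hadd]
    refine HasLinearization.add ((ih _ hσlt _ rfl).mono hle) ?_ hunion hsep
    exact heq ▸ ih _ (heq ▸ hωlt) _ rfl

theorem type_le_residualRank {β : Type} [LinearOrder β] [WellFoundedLT β] {g : β → X}
    (hg : ∀ p q, g p ≤ g q → p ≤ q) {S : Set X} (hS : range g ⊆ S) :
    Ordinal.type ((· < ·) : β → β → Prop) ≤ residualRank S := by
  have hresid : ∀ b : β, ∀ T : Set X, g b ∈ T → g '' Iio b ⊆ T →
      residualRank (g '' Iio b) < residualRank T := by
    intro b T hb hT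
    refine residualRank_lt ⟨g b, hb, ?_⟩
    rintro _ ⟨c, hc, rfl⟩
    exact ⟨hT ⟨c, hc, rfl⟩, fun hle => (hg _ _ hle).not_gt hc⟩
  have htypein : ∀ b : β, typein ((· < ·) : β → β → Prop) b ≤ residualRank (g '' Iio b) := by
    intro b
    induction b using WellFoundedLT.induction with
    | ind b ih =>
    refine le_of_forall_lt fun c hc => ?_
    obtain ⟨b', rfl⟩ := typein_surj ((· < ·) : β → β → Prop) (hc.trans (typein_lt_type _ b))
    have hb' : b' < b := (typein_lt_typein _).1 hc
    exact (ih b' hb').trans_lt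
      (hresid b' _ ⟨b', hb', rfl⟩ (image_mono (Iio_subset_Iio hb'.le)))
  refine le_of_forall_lt fun c hc => ?_
  obtain ⟨b, rfl⟩ := typein_surj ((· < ·) : β → β → Prop) hc
  exact (htypein b).trans_lt
    (hresid b S (hS (mem_range_self b)) ((image_subset_range _ _).trans hS))

theorem maxOrderType_eq_residualRank {Y : Type} [PartialOrder Y] (i : Y ↪o X) :
    maxOrderType Y = residualRank (range i) := by
  have hub : ∀ a ∈ { a : Ordinal.{0} |
      ∃ (β : Type) (_ : LinearOrder β) (_ : WellFoundedLT β) (g : β → Y),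
        Function.Surjective g ∧ (∀ p q : β, g p ≤ g q → p ≤ q) ∧
          Ordinal.type ((· < ·) : β → β → Prop) = a }, a ≤ residualRank (range i) := by
    rintro _ ⟨β, _, _, g, -, hg, rfl⟩
    exact type_le_residualRank (g := i ∘ g) (fun p q h => hg p q (i.le_iff_le.1 h))
      (range_comp_subset_range _ _)
  refine le_antisymm (csSup_le' hub) ?_
  obtain ⟨r, hr, hrlt, hle⟩ := hasLinearization_residualRank (range i)
  classical
  let e := Equiv.ofInjective i i.injective
  let L : LinearOrder (range i) := linearOrderOfSTO r
  have hL : @WellFoundedLT (range i) L.toLT := ⟨hr.wf⟩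
  refine hle.trans (le_csSup ⟨_, hub⟩ ⟨range i, L, hL, e.symm, e.symm.surjective,
    fun p q hpq => ?_, rfl⟩)
  have hpq' : p.1 ≤ q.1 := by
    have h := i.le_iff_le.2 hpq
    rwa [Equiv.apply_ofInjective_symm i.injective p,
      Equiv.apply_ofInjective_symm i.injective q] at h
  rcases hpq'.eq_or_lt with h | h
  · exact Or.inl (Subtype.ext h)
  · exact Or.inr (hrlt p q h)

end Rank

theorem stmt_16 (X : Type) [PartialOrder X]
    (hwpo : ∀ s : ℕ → X, ∃ i j, i < j ∧ s i ≤ s j) :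
    maxOrderType X = ⨆ σ : X, (maxOrderType {τ : X // ¬ σ ≤ τ} + 1) := by
  have hwf := isWellFounded_isResidual hwpo
  have hX : maxOrderType X = residualRank (univ : Set X) := by
    rw [maxOrderType_eq_residualRank (RelIso.refl (α := X) (· ≤ ·)).toRelEmbedding]
    congr 1
    exact range_id
  have hL : ∀ σ : X, maxOrderType {τ : X // ¬ σ ≤ τ} = residualRank (residualSet univ σ) := by
    intro σ
    rw [maxOrderType_eq_residualRank (OrderEmbedding.subtype fun τ : X => ¬ σ ≤ τ)]
    congr 1
    ext τ
    simp [residualSet]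
  simp only [hX, hL]
  apply le_antisymm
  · refine residualRank_le fun T ⟨σ, hσ, hT⟩ => ?_
    exact ((residualRank_mono hT).trans_lt (lt_add_one _)).trans_le
      (Ordinal.le_iSup (fun σ : X => residualRank (residualSet univ σ) + 1) σ)
  · exact Ordinal.iSup_le fun σ =>
      Order.add_one_le_of_lt (residualRank_lt (isResidual_residualSet (mem_univ σ)))
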